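/- Let θ ∈ (0, π/4] be a real number and define the cubic polynomial p_θ(x) = x³ − ((cos(2θ) + 5)/2)·x² + ((4·cos(2θ)² + 7·cos(2θ) + 13)/8)·x − (3·cos(2θ) + 1)²/16. Then there exists a unique real number x* with 0 < x* < 1 and p_θ(x*) = 0. -/

import Mathlib

/-- A real cubic with positive value and nonpositive derivative at `1` has at most one root less
than `1`: given two such roots, the third would also be less than `1`, making the derivative at `1`
positive. -/
theorem cubic_root_unique_of_deriv_one_nonpos {s t u a b : ℝ} (h1 : 0 < 1 - s + t - u)
    (hd : 3 - 2 * s + t ≤ 0) (ha : a < 1) (hb : b < 1)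
    (hpa : a ^ 3 - s * a ^ 2 + t * a - u = 0) (hpb : b ^ 3 - s * b ^ 2 + t * b - u = 0) :
    a = b := by
  by_contra hab
  have ht : t = a * b + (s - a - b) * (a + b) := by
    apply mul_left_cancel₀ (sub_ne_zero.mpr hab)
    linear_combination hpa - hpb
  have hu : u = a * b * (s - a - b) := by
    subst ht
    linear_combination -hpa
  subst ht hu
  have hA : 0 < 1 - a := sub_pos.mpr ha
  have hB : 0 < 1 - b := sub_pos.mpr hb
  have hR : 0 < 1 - (s - a - b) := by
    refine pos_of_mul_pos_right (a := (1 - a) * (1 - b)) ?_ (by positivity)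
    linarith
  nlinarith [mul_pos hA hB, mul_pos hA hR, mul_pos hB hR]

/-- For every real `θ ∈ (0, π/4]`, the cubic
`p_θ(x) = x³ - ((cos 2θ + 5)/2)·x² + ((4·cos²2θ + 7·cos 2θ + 13)/8)·x - (3·cos 2θ + 1)²/16`
has a unique real root `x*` with `0 < x* < 1`. -/
theorem cubic_unique_root_in_unit_interval (θ : ℝ) (hθ1 : 0 < θ)
    (hθ2 : θ ≤ Real.pi / 4) :
    ∃! x : ℝ, (0 < x ∧ x < 1) ∧
      x ^ 3 - ((Real.cos (2 * θ) + 5) / 2) * x ^ 2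
        + ((4 * Real.cos (2 * θ) ^ 2 + 7 * Real.cos (2 * θ) + 13) / 8) * x
        - (3 * Real.cos (2 * θ) + 1) ^ 2 / 16 = 0 := by
  have hc0 : 0 ≤ Real.cos (2 * θ) :=
    Real.cos_nonneg_of_neg_pi_div_two_le_of_le (by linarith) (by linarith)
  have hc1 : Real.cos (2 * θ) < 1 := by
    rw [← Real.cos_zero]
    exact Real.cos_lt_cos_of_nonneg_of_le_pi le_rfl (by linarith [Real.pi_pos]) (by linarith)
  generalize Real.cos (2 * θ) = c at hc0 hc1 ⊢
  obtain ⟨x, hx, hpx⟩ := intermediate_value_Ioo (zero_le_one' ℝ)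
    (f := fun x : ℝ => x ^ 3 - ((c + 5) / 2) * x ^ 2
      + ((4 * c ^ 2 + 7 * c + 13) / 8) * x - (3 * c + 1) ^ 2 / 16)
    (by fun_prop) (show (0 : ℝ) ∈ _ by constructor <;> nlinarith)
  refine ⟨x, ⟨hx, hpx⟩, fun y ⟨hy, hpy⟩ => ?_⟩
  exact cubic_root_unique_of_deriv_one_nonpos (by nlinarith) (by nlinarith) hy.2 hx.2 hpy hpx
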